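/- Consider y_t = θ* + w_t for t = 1,…,n with n > 2 and θ* ∈ ℝ, and let α_1 = 1, α_2 = −1, and α_3,…,α_n be arbitrary values in {−1, +1}. Define S_0(θ) = Σ_{t=1}^n (y_t − θ) and S_1(θ) = Σ_{t=1}^n α_t (y_t − θ). Then the set {θ ∈ ℝ : S_0(θ)² ≤ S_1(θ)²} is the closed bounded interval with endpoints θ_1 and θ_2, where θ_1 = θ* + (Σ_{t=1}^n (1+α_t) w_t)/(Σ_{t=1}^n (1+α_t)) and θ_2 = θ* + (Σ_{t=1}^n (1−α_t) w_t)/(Σ_{t=1}^n (1−α_t)); that is, the set equals [min(θ_1,θ_2), max(θ_1,θ_2)]. -/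

import Mathlib

open Finset

lemma sum_mul_add_sub_eq {ι : Type*} (s : Finset ι) (c w : ι → ℝ) (a θ : ℝ)
    (hc : ∑ t ∈ s, c t ≠ 0) :
    ∑ t ∈ s, c t * (a + w t - θ) =
      (∑ t ∈ s, c t) * (a + (∑ t ∈ s, c t * w t) / (∑ t ∈ s, c t) - θ) := by
  have h : ∑ t ∈ s, c t * (a + w t - θ) =
      (∑ t ∈ s, c t) * (a - θ) + ∑ t ∈ s, c t * w t := by
    rw [Finset.sum_mul, ← Finset.sum_add_distrib]
    exact Finset.sum_congr rfl fun t _ => by ring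
  rw [h]
  field_simp
  ring

lemma sub_mul_sub_nonpos_iff_mem_uIcc (a b x : ℝ) :
    (a - x) * (b - x) ≤ 0 ↔ x ∈ Set.uIcc a b := by
  rw [Set.mem_uIcc, mul_nonpos_iff]
  simp only [sub_nonneg, sub_nonpos]
  tauto

/-- **The 0.5-level SPS confidence set is an interval.**
For `y t = θ* + w t`, `α 1 = 1`, `α 2 = -1` and arbitrary signs `α t ∈ {-1,1}`,
the set `{θ | S₀(θ)² ≤ S₁(θ)²}` is exactly the closed interval with endpoints
`θ₁ = θ* + (∑ (1+αₜ)wₜ)/(∑ (1+αₜ))` and `θ₂ = θ* + (∑ (1-αₜ)wₜ)/(∑ (1-αₜ))`. -/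
theorem sps_half_level_region_is_interval
    (n : ℕ) (hn : 2 < n)
    (θstar : ℝ) (w : ℕ → ℝ) (α : ℕ → ℝ) (y : ℕ → ℝ)
    (hy : ∀ t, y t = θstar + w t)
    (hα1 : α 1 = 1) (hα2 : α 2 = -1)
    (hα : ∀ t ∈ Finset.Icc 1 n, α t = 1 ∨ α t = -1)
    (θ₁ θ₂ : ℝ)
    (hθ₁ : θ₁ = θstar + (∑ t ∈ Finset.Icc 1 n, (1 + α t) * w t) /
                        (∑ t ∈ Finset.Icc 1 n, (1 + α t)))
    (hθ₂ : θ₂ = θstar + (∑ t ∈ Finset.Icc 1 n, (1 - α t) * w t) /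
                        (∑ t ∈ Finset.Icc 1 n, (1 - α t))) :
    {θ : ℝ | (∑ t ∈ Finset.Icc 1 n, (y t - θ))^2
              ≤ (∑ t ∈ Finset.Icc 1 n, α t * (y t - θ))^2}
      = Set.Icc (min θ₁ θ₂) (max θ₁ θ₂) := by
  have hP : 0 < ∑ t ∈ Finset.Icc 1 n, (1 + α t) :=
    Finset.sum_pos' (fun t ht => by rcases hα t ht with h | h <;> norm_num [h])
      ⟨1, Finset.mem_Icc.2 ⟨le_rfl, by omega⟩, by norm_num [hα1]⟩
  have hQ : 0 < ∑ t ∈ Finset.Icc 1 n, (1 - α t) :=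
    Finset.sum_pos' (fun t ht => by rcases hα t ht with h | h <;> norm_num [h])
      ⟨2, Finset.mem_Icc.2 ⟨by omega, hn.le⟩, by norm_num [hα2]⟩
  ext θ
  have hadd : ∑ t ∈ Finset.Icc 1 n, (y t - θ) + ∑ t ∈ Finset.Icc 1 n, α t * (y t - θ) =
      (∑ t ∈ Finset.Icc 1 n, (1 + α t)) * (θ₁ - θ) := by
    rw [hθ₁, ← sum_mul_add_sub_eq _ _ w θstar θ hP.ne', ← Finset.sum_add_distrib]
    exact Finset.sum_congr rfl fun t _ => by rw [hy]; ring
  have hsub : ∑ t ∈ Finset.Icc 1 n, (y t - θ) - ∑ t ∈ Finset.Icc 1 n, α t * (y t - θ) =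
      (∑ t ∈ Finset.Icc 1 n, (1 - α t)) * (θ₂ - θ) := by
    rw [hθ₂, ← sum_mul_add_sub_eq _ _ w θstar θ hQ.ne', ← Finset.sum_sub_distrib]
    exact Finset.sum_congr rfl fun t _ => by rw [hy]; ring
  change _ ↔ θ ∈ Set.uIcc θ₁ θ₂
  rw [← sub_mul_sub_nonpos_iff_mem_uIcc, Set.mem_ofPred_eq, ← sub_nonpos, sq_sub_sq, hadd, hsub,
    mul_mul_mul_comm]
  exact smul_nonpos_iff_nonpos_of_pos_left (mul_pos hP hQ)
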